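/- Let X ∈ ℝ^{m×n} be nonnegative, let A₁ ∈ ℝ^{k×m} and A₂ ∈ ℝ^{n×k} be such that A₁XA₂ is invertible, and let Q₁ and Q₂ be matrices with orthonormal columns such that Q₁Q₁ᵀ is the orthogonal projection onto the column space of XA₂ (an m×m matrix) and Q₂Q₂ᵀ is the orthogonal projection onto the row space of A₁X (an n×n matrix). Fix λ₁, λ₂ ≥ 0 and σ₁, σ₂ satisfying σ₁ ≥ max{(A₁ᵀA₁)₋} , σ₁ ≥ max{(A₁ᵀA₁ + λ₁(I_m − Q₁Q₁ᵀ))₋}, σ₂ ≥ max{(A₂A₂ᵀ)₋}, and σ₂ ≥ max{(A₂A₂ᵀ + λ₂(I_n − Q₂Q₂ᵀ))₋}. Define A_{1,σ} = A₁ᵀA₁ + σ₁1_m1_mᵀ and A_{2,σ} = A₂A₂ᵀ + σ₂1_n1_nᵀ, and the objective g(U,V) = ‖A₁(X−UVᵀ)‖_F² + ‖(X−UVᵀ)A₂‖_F² + λ₁‖(I_m − Q₁Q₁ᵀ)UVᵀ‖_F² + λ₂‖UVᵀ(I_n − Q₂Q₂ᵀ)‖_F² + σ₁‖1_mᵀ(X−UVᵀ)‖²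 + σ₂‖(X−UVᵀ)1_n‖² for U ∈ ℝ^{m×r}, V ∈ ℝ^{n×r}. Then for any entrywise nonnegative U, V for which the respective denominators below are entrywise positive, g does not increase under the updates U ← U ∘ (A_{1,σ}XV + XA_{2,σ}V) / ((A_{1,σ} + λ₁(I_m − Q₁Q₁ᵀ))UVᵀV + UVᵀ(A_{2,σ} + λ₂(I_n − Q₂Q₂ᵀ))V) and V ← V ∘ (XᵀA_{1,σ}U + A_{2,σ}XᵀU) / (VUᵀ(A_{1,σ} + λ₁(I_m − Q₁Q₁ᵀ))U + (A_{2,σ} + λ₂(I_n − Q₂Q₂ᵀ))VUᵀU), and the updated matrices remain entrywise nonnegative. -/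

import Mathlib

open Matrix

/-- Squared Frobenius norm of a real matrix. -/
noncomputable def frobSq {m n : ℕ} (M : Matrix (Fin m) (Fin n) ℝ) : ℝ :=
  ∑ i, ∑ j, (M i j) ^ 2

/-- The all-ones matrix `1_a 1_bᵀ`. -/
def onesMat (a b : ℕ) : Matrix (Fin a) (Fin b) ℝ := Matrix.of fun _ _ => 1

/-- The quadratic form `M ↦ tr (Mᵀ S M)`. -/
def traceQuad {p q : ℕ} (S : Matrix (Fin p) (Fin p) ℝ) (M : Matrix (Fin p) (Fin q) ℝ) : ℝ :=
  (Mᵀ * S * M).trace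

lemma traceQuad_add {p q : ℕ} {S : Matrix (Fin p) (Fin p) ℝ} (hS : Sᵀ = S)
    (M N : Matrix (Fin p) (Fin q) ℝ) :
    traceQuad S (M + N) = traceQuad S M + 2 * (Nᵀ * S * M).trace + traceQuad S N := by
  have h : (Mᵀ * S * N).trace = (Nᵀ * S * M).trace := by
    rw [← trace_transpose]
    simp [hS, Matrix.mul_assoc]
  simp only [traceQuad, transpose_add, Matrix.add_mul, Matrix.mul_add, trace_add, h]
  ring

lemma traceQuad_add_left {p q : ℕ} (S T : Matrix (Fin p) (Fin p) ℝ)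
    (M : Matrix (Fin p) (Fin q) ℝ) :
    traceQuad (S + T) M = traceQuad S M + traceQuad T M := by
  simp [traceQuad, Matrix.add_mul, Matrix.mul_add]

lemma traceQuad_smul_left {p q : ℕ} (c : ℝ) (S : Matrix (Fin p) (Fin p) ℝ)
    (M : Matrix (Fin p) (Fin q) ℝ) :
    traceQuad (c • S) M = c * traceQuad S M := by
  simp [traceQuad]

lemma trace_transpose_mul_eq_sum {p q : ℕ} (M N : Matrix (Fin p) (Fin q) ℝ) :
    (Mᵀ * N).trace = ∑ i, ∑ j, M i j * N i j := by
  simp only [trace, diag_apply, mul_apply, transpose_apply]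
  exact Finset.sum_comm

lemma frobSq_eq_trace {p q : ℕ} (M : Matrix (Fin p) (Fin q) ℝ) :
    frobSq M = (Mᵀ * M).trace := by
  simp only [trace_transpose_mul_eq_sum, frobSq, sq]

lemma frobSq_transpose {p q : ℕ} (M : Matrix (Fin p) (Fin q) ℝ) :
    frobSq Mᵀ = frobSq M :=
  Finset.sum_comm

lemma frobSq_mul {p q s : ℕ} (A : Matrix (Fin s) (Fin p) ℝ) (M : Matrix (Fin p) (Fin q) ℝ) :
    frobSq (A * M) = traceQuad (Aᵀ * A) M := by
  simp [frobSq_eq_trace, traceQuad, Matrix.mul_assoc]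

lemma frobSq_mul_right {p q s : ℕ} (M : Matrix (Fin p) (Fin q) ℝ) (A : Matrix (Fin q) (Fin s) ℝ) :
    frobSq (M * A) = traceQuad (A * Aᵀ) Mᵀ := by
  rw [← frobSq_transpose, transpose_mul, frobSq_mul, transpose_transpose]

lemma sum_colSum_sq {p q : ℕ} (M : Matrix (Fin p) (Fin q) ℝ) :
    ∑ j, (∑ i, M i j) ^ 2 = traceQuad (onesMat p p) M := by
  simp [traceQuad, trace, mul_apply, onesMat, sq, Finset.mul_sum]

lemma onesMat_transpose (a b : ℕ) : (onesMat a b)ᵀ = onesMat b a := rfl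

lemma one_sub_proj_transpose {p s : ℕ} (Q : Matrix (Fin p) (Fin s) ℝ) :
    (1 - Q * Qᵀ)ᵀ = 1 - Q * Qᵀ := by
  simp

lemma one_sub_proj_mul_self {p s : ℕ} {Q : Matrix (Fin p) (Fin s) ℝ} (hQ : Qᵀ * Q = 1) :
    (1 - Q * Qᵀ) * (1 - Q * Qᵀ) = 1 - Q * Qᵀ := by
  have h : Q * Qᵀ * (Q * Qᵀ) = Q * Qᵀ := by
    rw [Matrix.mul_assoc, ← Matrix.mul_assoc Qᵀ, hQ, Matrix.one_mul]
  simp [Matrix.sub_mul, Matrix.mul_sub, h]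

lemma Matrix.mul_entry_nonneg {p q s : ℕ} {M : Matrix (Fin p) (Fin q) ℝ}
    {N : Matrix (Fin q) (Fin s) ℝ} (hM : ∀ i j, 0 ≤ M i j) (hN : ∀ i j, 0 ≤ N i j) (i : Fin p)
    (j : Fin s) : 0 ≤ (M * N) i j := by
  rw [mul_apply]
  exact Finset.sum_nonneg fun l _ => mul_nonneg (hM i l) (hN l j)

/-- A symmetric nonnegative kernel is dominated, after scaling by a nonnegative vector `u`,
by the diagonal form with entries `(K u)ₓ / uₓ`. -/
lemma sum_kernel_le_sum_diag {ι : Type*} [Fintype ι] {K : ι → ι → ℝ}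
    (hK : ∀ x y, 0 ≤ K x y) (hsymm : ∀ x y, K x y = K y x) {u : ι → ℝ} (hu : ∀ x, 0 ≤ u x)
    (t : ι → ℝ) :
    ∑ x, ∑ y, K x y * (u x * t x) * (u y * t y) ≤ ∑ x, ∑ y, K x y * u x * u y * t x ^ 2 := by
  have hswap : ∑ x, ∑ y, K x y * u x * u y * t y ^ 2 = ∑ x, ∑ y, K x y * u x * u y * t x ^ 2 := by
    rw [Finset.sum_comm]
    refine Finset.sum_congr rfl fun x _ => Finset.sum_congr rfl fun y _ => ?_
    rw [hsymm y x]
    ring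
  have hle : 2 * ∑ x, ∑ y, K x y * (u x * t x) * (u y * t y) ≤
      ∑ x, ∑ y, K x y * u x * u y * t x ^ 2 + ∑ x, ∑ y, K x y * u x * u y * t y ^ 2 := by
    simp only [Finset.mul_sum, ← Finset.sum_add_distrib]
    refine Finset.sum_le_sum fun x _ => Finset.sum_le_sum fun y _ => ?_
    have h := mul_nonneg (mul_nonneg (mul_nonneg (hK x y) (hu x)) (hu y)) (sq_nonneg (t x - t y))
    nlinarith [h]
  linarith

lemma trace_hadamard_quad_le {p q : ℕ} {M : Matrix (Fin p) (Fin p) ℝ}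
    {N : Matrix (Fin q) (Fin q) ℝ} (hM : ∀ i j, 0 ≤ M i j) (hN : ∀ i j, 0 ≤ N i j)
    (hMs : Mᵀ = M) (hNs : Nᵀ = N) {U : Matrix (Fin p) (Fin q) ℝ} (hU : ∀ i a, 0 ≤ U i a)
    (T : Matrix (Fin p) (Fin q) ℝ) :
    ((U ⊙ T)ᵀ * (M * (U ⊙ T) * N)).trace ≤ ∑ i, ∑ a, U i a * T i a ^ 2 * (M * U * N) i a := by
  have hMs' : ∀ i j, M i j = M j i := fun i j => congrFun (congrFun hMs.symm i) j
  have hNs' : ∀ i j, N i j = N j i := fun i j => congrFun (congrFun hNs.symm i) j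
  have h := sum_kernel_le_sum_diag (ι := Fin p × Fin q) (K := fun x y => M x.1 y.1 * N y.2 x.2)
    (fun x y => mul_nonneg (hM _ _) (hN _ _))
    (fun x y => by rw [hMs' x.1, hNs' y.2]) (u := fun x => U x.1 x.2) (fun x => hU _ _)
    (fun x => T x.1 x.2)
  have hexp : ∀ (B : Matrix (Fin p) (Fin q) ℝ) i a,
      (M * B * N) i a = ∑ j, ∑ b, M i j * B j b * N b a := by
    intro B i a
    simp only [mul_apply, Finset.sum_mul]
    exact Finset.sum_comm
  simp only [Fintype.sum_prod_type] at h
  simp only [trace_transpose_mul_eq_sum, hexp, hadamard_apply, Finset.mul_sum]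
  refine le_trans (le_of_eq ?_) (h.trans (le_of_eq ?_)) <;>
  · refine Finset.sum_congr rfl fun i _ => Finset.sum_congr rfl fun a _ =>
      Finset.sum_congr rfl fun j _ => Finset.sum_congr rfl fun b _ => ?_
    ring

/-- The doubly weighted least-squares objective with quadratic regularizers. -/
def weightedObjective {m n : ℕ} (X : Matrix (Fin m) (Fin n) ℝ) (S₁ R₁ : Matrix (Fin m) (Fin m) ℝ)
    (S₂ R₂ : Matrix (Fin n) (Fin n) ℝ) (W : Matrix (Fin m) (Fin n) ℝ) : ℝ :=
  traceQuad S₁ (X - W) + traceQuad S₂ (X - W)ᵀ + traceQuad R₁ W + traceQuad R₂ Wᵀ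

lemma weightedObjective_transpose {m n : ℕ} (X : Matrix (Fin m) (Fin n) ℝ)
    (S₁ R₁ : Matrix (Fin m) (Fin m) ℝ) (S₂ R₂ : Matrix (Fin n) (Fin n) ℝ)
    (W : Matrix (Fin m) (Fin n) ℝ) :
    weightedObjective Xᵀ S₂ R₂ S₁ R₁ Wᵀ = weightedObjective X S₁ R₁ S₂ R₂ W := by
  simp only [weightedObjective, ← transpose_sub, transpose_transpose]
  ring

lemma weightedObjective_add_mul {m n r : ℕ} (X : Matrix (Fin m) (Fin n) ℝ)
    {S₁ R₁ : Matrix (Fin m) (Fin m) ℝ} {S₂ R₂ : Matrix (Fin n) (Fin n) ℝ}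
    (hS₁ : S₁ᵀ = S₁) (hR₁ : R₁ᵀ = R₁) (hS₂ : S₂ᵀ = S₂) (hR₂ : R₂ᵀ = R₂)
    (U D : Matrix (Fin m) (Fin r) ℝ) (V : Matrix (Fin n) (Fin r) ℝ) :
    weightedObjective X S₁ R₁ S₂ R₂ ((U + D) * Vᵀ) = weightedObjective X S₁ R₁ S₂ R₂ (U * Vᵀ)
      + 2 * (Dᵀ * (((S₁ + R₁) * U * Vᵀ * V + U * Vᵀ * (S₂ + R₂) * V)
        - (S₁ * X * V + X * S₂ * V))).trace
      + (Dᵀ * ((S₁ + R₁) * D * (Vᵀ * V))).trace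
      + (Dᵀ * ((1 : Matrix (Fin m) (Fin m) ℝ) * D * (Vᵀ * (S₂ + R₂) * V))).trace := by
  have hsub : X - (U + D) * Vᵀ = (X - U * Vᵀ) + (-D) * Vᵀ := by
    rw [Matrix.add_mul, Matrix.neg_mul]; abel
  have hleft : ∀ (B : Matrix (Fin m) (Fin r) ℝ) (S : Matrix (Fin m) (Fin m) ℝ)
      (E : Matrix (Fin m) (Fin n) ℝ),
      ((B * Vᵀ)ᵀ * S * E).trace = (Bᵀ * (S * E * V)).trace := by
    intro B S E
    rw [transpose_mul, transpose_transpose, Matrix.mul_assoc, Matrix.mul_assoc, trace_mul_comm]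
    simp only [Matrix.mul_assoc]
  have hright : ∀ (B : Matrix (Fin m) (Fin r) ℝ) (S : Matrix (Fin n) (Fin n) ℝ)
      (E : Matrix (Fin m) (Fin n) ℝ), Sᵀ = S →
      ((B * Vᵀ)ᵀᵀ * S * Eᵀ).trace = (Bᵀ * (E * S * V)).trace := by
    intro B S E hS
    rw [← trace_transpose, ← trace_mul_comm]
    simp [hS, Matrix.mul_assoc]
  rw [weightedObjective, hsub, Matrix.add_mul, transpose_add, transpose_add, traceQuad_add hS₁,
    traceQuad_add hS₂, traceQuad_add hR₁, traceQuad_add hR₂, weightedObjective]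
  simp only [hleft, hright _ _ _ hS₂, hright _ _ _ hR₂]
  simp only [traceQuad, hleft, hright _ _ _ hS₂, hright _ _ _ hR₂]
  simp only [Matrix.add_mul, Matrix.mul_add, Matrix.sub_mul, Matrix.mul_sub, trace_add, trace_sub,
    transpose_neg, Matrix.neg_mul, Matrix.mul_neg, trace_neg, Matrix.mul_assoc, Matrix.one_mul]
  ring

lemma weightedObjective_update_le {m n r : ℕ} {X : Matrix (Fin m) (Fin n) ℝ}
    {S₁ R₁ : Matrix (Fin m) (Fin m) ℝ} {S₂ R₂ : Matrix (Fin n) (Fin n) ℝ}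
    (hS₁ : S₁ᵀ = S₁) (hR₁ : R₁ᵀ = R₁) (hS₂ : S₂ᵀ = S₂) (hR₂ : R₂ᵀ = R₂)
    (h₁ : ∀ i j, 0 ≤ (S₁ + R₁) i j) (h₂ : ∀ i j, 0 ≤ (S₂ + R₂) i j)
    {U : Matrix (Fin m) (Fin r) ℝ} {V : Matrix (Fin n) (Fin r) ℝ}
    (hU : ∀ i a, 0 ≤ U i a) (hV : ∀ i a, 0 ≤ V i a) {Num Den : Matrix (Fin m) (Fin r) ℝ}
    (hNum : Num = S₁ * X * V + X * S₂ * V)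
    (hDen : Den = (S₁ + R₁) * U * Vᵀ * V + U * Vᵀ * (S₂ + R₂) * V)
    (hpos : ∀ i a, 0 < Den i a) :
    weightedObjective X S₁ R₁ S₂ R₂ ((Matrix.of fun i a => U i a * Num i a / Den i a) * Vᵀ)
      ≤ weightedObjective X S₁ R₁ S₂ R₂ (U * Vᵀ) := by
  set T : Matrix (Fin m) (Fin r) ℝ := Matrix.of fun i a => (Num i a - Den i a) / Den i a with hT
  have hupd : (Matrix.of fun i a => U i a * Num i a / Den i a) = U + U ⊙ T := by
    ext i a
    have := (hpos i a).ne'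
    simp only [hT, of_apply, Matrix.add_apply, hadamard_apply]
    field_simp
    ring
  have hVt : ∀ i a, 0 ≤ Vᵀ i a := fun i a => hV a i
  have hq₁ := trace_hadamard_quad_le h₁ (mul_entry_nonneg hVt hV) (by simp [hS₁, hR₁])
    (by simp) hU T
  have hq₂ := trace_hadamard_quad_le (M := (1 : Matrix (Fin m) (Fin m) ℝ))
    (fun i j => by rw [one_apply]; split_ifs <;> norm_num)
    (mul_entry_nonneg (mul_entry_nonneg hVt h₂) hV) (by simp)
    (by simp [hS₂, hR₂, Matrix.mul_assoc]) hU T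
  have hquad : ∑ i, ∑ a, U i a * T i a ^ 2 * ((S₁ + R₁) * U * (Vᵀ * V)) i a
      + ∑ i, ∑ a, U i a * T i a ^ 2 * ((1 : Matrix (Fin m) (Fin m) ℝ) * U * (Vᵀ * (S₂ + R₂) * V)) i a
      = ∑ i, ∑ a, U i a * T i a ^ 2 * Den i a := by
    simp only [← Finset.sum_add_distrib, ← mul_add, ← Matrix.add_apply, hDen, Matrix.one_mul,
      Matrix.mul_assoc]
  have hlin : ((U ⊙ T)ᵀ * (Den - Num)).trace = -∑ i, ∑ a, U i a * T i a ^ 2 * Den i a := by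
    simp only [trace_transpose_mul_eq_sum, ← Finset.sum_neg_distrib]
    refine Finset.sum_congr rfl fun i _ => Finset.sum_congr rfl fun a _ => ?_
    have := (hpos i a).ne'
    simp only [hT, of_apply, Matrix.sub_apply, hadamard_apply]
    field_simp
    ring
  have hnonneg : 0 ≤ ∑ i, ∑ a, U i a * T i a ^ 2 * Den i a :=
    Finset.sum_nonneg fun i _ => Finset.sum_nonneg fun a _ =>
      mul_nonneg (mul_nonneg (hU i a) (sq_nonneg _)) (hpos i a).le
  rw [hupd, weightedObjective_add_mul X hS₁ hR₁ hS₂ hR₂, ← hDen, ← hNum, hlin]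
  linarith

lemma nonneg_add_smul_onesMat {p : ℕ} {M : Matrix (Fin p) (Fin p) ℝ} {σ : ℝ}
    (h : ∀ i j, max (-(M i j)) 0 ≤ σ) (i j : Fin p) : 0 ≤ (M + σ • onesMat p p) i j := by
  have := (le_max_left _ _).trans (h i j)
  simp only [Matrix.add_apply, Matrix.smul_apply, onesMat, of_apply, smul_eq_mul, mul_one]
  linarith

/-- Multiplicative updates for the two-sided compressed NMF objective with
projection regularizers and nonnegativity-correction shifts
(Corollary: two-sided updates). -/
theorem two_sided_multiplicative_updates
    {m n r k r₁ r₂ : ℕ}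
    (X : Matrix (Fin m) (Fin n) ℝ) (hX : ∀ i j, 0 ≤ X i j)
    (A₁ : Matrix (Fin k) (Fin m) ℝ) (A₂ : Matrix (Fin n) (Fin k) ℝ)
    (hinv : IsUnit (A₁ * X * A₂))
    -- Q₁, Q₂ have orthonormal columns; Q₁Q₁ᵀ is the orthogonal projection onto
    -- the column space of X*A₂, and Q₂Q₂ᵀ onto the row space of A₁*X
    (Q₁ : Matrix (Fin m) (Fin r₁) ℝ) (Q₂ : Matrix (Fin n) (Fin r₂) ℝ)
    (hQ₁o : Q₁ᵀ * Q₁ = 1) (hQ₂o : Q₂ᵀ * Q₂ = 1)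
    (hQ₁p : LinearMap.range (Q₁ * Q₁ᵀ).mulVecLin
      = LinearMap.range (X * A₂).mulVecLin)
    (hQ₂p : LinearMap.range (Q₂ * Q₂ᵀ).mulVecLin
      = LinearMap.range ((A₁ * X)ᵀ).mulVecLin)
    (lam₁ lam₂ : ℝ) (hlam₁ : 0 ≤ lam₁) (hlam₂ : 0 ≤ lam₂)
    (σ₁ σ₂ : ℝ)
    (hσ₁a : ∀ i j, max (-((A₁ᵀ * A₁) i j)) 0 ≤ σ₁)
    (hσ₁b : ∀ i j,
      max (-((A₁ᵀ * A₁ + lam₁ • ((1 : Matrix (Fin m) (Fin m) ℝ) - Q₁ * Q₁ᵀ)) i j)) 0 ≤ σ₁)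
    (hσ₂a : ∀ i j, max (-((A₂ * A₂ᵀ) i j)) 0 ≤ σ₂)
    (hσ₂b : ∀ i j,
      max (-((A₂ * A₂ᵀ + lam₂ • ((1 : Matrix (Fin n) (Fin n) ℝ) - Q₂ * Q₂ᵀ)) i j)) 0 ≤ σ₂)
    -- the shifted sketch matrices
    (A₁σ : Matrix (Fin m) (Fin m) ℝ) (hA₁σ : A₁σ = A₁ᵀ * A₁ + σ₁ • onesMat m m)
    (A₂σ : Matrix (Fin n) (Fin n) ℝ) (hA₂σ : A₂σ = A₂ * A₂ᵀ + σ₂ • onesMat n n)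
    -- the objective
    (g : Matrix (Fin m) (Fin r) ℝ → Matrix (Fin n) (Fin r) ℝ → ℝ)
    (hg : ∀ U V, g U V =
      frobSq (A₁ * (X - U * Vᵀ)) + frobSq ((X - U * Vᵀ) * A₂)
        + lam₁ * frobSq ((1 - Q₁ * Q₁ᵀ) * (U * Vᵀ))
        + lam₂ * frobSq ((U * Vᵀ) * (1 - Q₂ * Q₂ᵀ))
        + σ₁ * ∑ j, (∑ i, (X - U * Vᵀ) i j) ^ 2
        + σ₂ * ∑ i, (∑ j, (X - U * Vᵀ) i j) ^ 2)
    (U : Matrix (Fin m) (Fin r) ℝ) (V : Matrix (Fin n) (Fin r) ℝ)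
    (hU : ∀ i a, 0 ≤ U i a) (hV : ∀ i a, 0 ≤ V i a)
    -- numerators and denominators of the updates
    (NumU DenU : Matrix (Fin m) (Fin r) ℝ)
    (hNumU : NumU = A₁σ * X * V + X * A₂σ * V)
    (hDenU : DenU = (A₁σ + lam₁ • ((1 : Matrix (Fin m) (Fin m) ℝ) - Q₁ * Q₁ᵀ)) * U * Vᵀ * V
      + U * Vᵀ * (A₂σ + lam₂ • ((1 : Matrix (Fin n) (Fin n) ℝ) - Q₂ * Q₂ᵀ)) * V)
    (NumV DenV : Matrix (Fin n) (Fin r) ℝ)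
    (hNumV : NumV = Xᵀ * A₁σ * U + A₂σ * Xᵀ * U)
    (hDenV : DenV = V * Uᵀ * (A₁σ + lam₁ • ((1 : Matrix (Fin m) (Fin m) ℝ) - Q₁ * Q₁ᵀ)) * U
      + (A₂σ + lam₂ • ((1 : Matrix (Fin n) (Fin n) ℝ) - Q₂ * Q₂ᵀ)) * V * Uᵀ * U) :
    ((∀ i a, 0 < DenU i a) →
      (∀ i a, 0 ≤ (Matrix.of fun i a => U i a * NumU i a / DenU i a :
        Matrix (Fin m) (Fin r) ℝ) i a) ∧
      g (Matrix.of fun i a => U i a * NumU i a / DenU i a) V ≤ g U V)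
    ∧ ((∀ i a, 0 < DenV i a) →
      (∀ i a, 0 ≤ (Matrix.of fun i a => V i a * NumV i a / DenV i a :
        Matrix (Fin n) (Fin r) ℝ) i a) ∧
      g U (Matrix.of fun i a => V i a * NumV i a / DenV i a) ≤ g U V) := by
  set R₁ := lam₁ • ((1 : Matrix (Fin m) (Fin m) ℝ) - Q₁ * Q₁ᵀ) with hR₁
  set R₂ := lam₂ • ((1 : Matrix (Fin n) (Fin n) ℝ) - Q₂ * Q₂ᵀ) with hR₂
  have hgW : ∀ U V, g U V = weightedObjective X A₁σ R₁ A₂σ R₂ (U * Vᵀ) := by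
    intro U V
    have hrow : ∀ E : Matrix (Fin m) (Fin n) ℝ,
        ∑ i, (∑ j, E i j) ^ 2 = traceQuad (onesMat n n) Eᵀ := fun E => sum_colSum_sq Eᵀ
    rw [hg, frobSq_mul A₁, frobSq_mul (1 - _), frobSq_mul_right, frobSq_mul_right, sum_colSum_sq, hrow,
      one_sub_proj_transpose, one_sub_proj_transpose, one_sub_proj_mul_self hQ₁o,
      one_sub_proj_mul_self hQ₂o, weightedObjective, hA₁σ, hA₂σ, hR₁, hR₂]
    simp only [traceQuad_add_left, traceQuad_smul_left]
    ring
  have hS₁t : A₁σᵀ = A₁σ := by simp [hA₁σ, onesMat_transpose]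
  have hS₂t : A₂σᵀ = A₂σ := by simp [hA₂σ, onesMat_transpose]
  have hR₁t : R₁ᵀ = R₁ := by simp [hR₁]
  have hR₂t : R₂ᵀ = R₂ := by simp [hR₂]
  have hS₁ : ∀ i j, 0 ≤ A₁σ i j := hA₁σ ▸ nonneg_add_smul_onesMat hσ₁a
  have hS₂ : ∀ i j, 0 ≤ A₂σ i j := hA₂σ ▸ nonneg_add_smul_onesMat hσ₂a
  have hSR₁ : ∀ i j, 0 ≤ (A₁σ + R₁) i j := by
    rw [hA₁σ, add_right_comm]; exact nonneg_add_smul_onesMat hσ₁b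
  have hSR₂ : ∀ i j, 0 ≤ (A₂σ + R₂) i j := by
    rw [hA₂σ, add_right_comm]; exact nonneg_add_smul_onesMat hσ₂b
  have hXt : ∀ i j, 0 ≤ Xᵀ i j := fun i j => hX j i
  refine ⟨fun hpos => ⟨fun i a => ?_, ?_⟩, fun hpos => ⟨fun i a => ?_, ?_⟩⟩
  · refine div_nonneg (mul_nonneg (hU i a) ?_) (hpos i a).le
    rw [hNumU]
    exact add_nonneg (mul_entry_nonneg (mul_entry_nonneg hS₁ hX) hV i a)
      (mul_entry_nonneg (mul_entry_nonneg hX hS₂) hV i a)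
  · rw [hgW, hgW]
    exact weightedObjective_update_le hS₁t hR₁t hS₂t hR₂t hSR₁ hSR₂ hU hV hNumU hDenU hpos
  · refine div_nonneg (mul_nonneg (hV i a) ?_) (hpos i a).le
    rw [hNumV]
    exact add_nonneg (mul_entry_nonneg (mul_entry_nonneg hXt hS₁) hU i a)
      (mul_entry_nonneg (mul_entry_nonneg hS₂ hXt) hU i a)
  · rw [hgW, hgW, ← weightedObjective_transpose, ← weightedObjective_transpose X _ _ _ _ (U * Vᵀ),
      transpose_mul, transpose_mul, transpose_transpose, transpose_transpose]
    exact weightedObjective_update_le hS₂t hR₂t hS₁t hR₁t hSR₂ hSR₁ hV hU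
      (hNumV.trans (add_comm _ _)) (hDenV.trans (add_comm _ _)) hpos
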